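/- Let s, d, m ∈ ℕ with 1 ≤ d < s ≤ m, and let F be a coloured graph containing an essential (s,d,m)-graph with essential blue paths G_1,…,G_s and essential red path P = u_1u_2…u_d. Let u_{d+1} be an end of the path G_{d+1}, and let F' be the coloured graph obtained from F by adding the edge u_d u_{d+1} (not previously an edge of F), coloured either red or blue. Then F' contains an essential (s',d',m)-graph where either d' = d+1 and s' = s, or s' = s−1 and d' ∈ {d−1, d} with d' ≥ 1. -/

import Mathlib

namespace OSR

/-- A partial red/blue colouring of the edges of the complete graph on `ℕ`:
`some true` = red, `some false` = blue, `none` = unselected. -/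
abbrev Coloring := Sym2 ℕ → Option Bool

/-- The colouring `C` contains a monochromatic path of colour `c` on `k` vertices. -/
def HasPath (C : Coloring) (c : Bool) (k : ℕ) : Prop :=
  ∃ f : Fin k → ℕ, Function.Injective f ∧
    ∀ i j : Fin k, (j : ℕ) = (i : ℕ) + 1 → C s(f i, f j) = some c

/-- A Builder strategy: given the current position, select an edge. -/
abbrev BuilderStrat := Coloring → Sym2 ℕ

/-- A Painter strategy: given the current position and the selected edge,
choose a colour (`true` = red, `false` = blue). -/
abbrev PainterStrat := Coloring → Sym2 ℕ → Bool

/-- The position after `t` rounds of play, starting from `C0`. -/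
def play (C0 : Coloring) (B : BuilderStrat) (P : PainterStrat) : ℕ → Coloring
  | 0 => C0
  | t + 1 =>
    Function.update (play C0 B P t) (B (play C0 B P t))
      (some (P (play C0 B P t) (B (play C0 B P t))))

/-- Builder plays legally: he always selects a previously unselected non-loop edge. -/
def BuilderOK (C0 : Coloring) (B : BuilderStrat) : Prop :=
  ∀ (P : PainterStrat) (t : ℕ),
    play C0 B P t (B (play C0 B P t)) = none ∧ ¬(B (play C0 B P t)).IsDiag

/-- The empty position: no edge has been coloured. -/
def emptyCol : Coloring := fun _ => none

/-- The online Ramsey game for `(P_k, P_n)` has ended: there is a red path on `k`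
vertices or a blue path on `n` vertices. -/
def Ends (k n : ℕ) (C : Coloring) : Prop := HasPath C true k ∨ HasPath C false n

/-- The online size Ramsey number `r̃(P_k, P_n)`: the least `t` such that Builder
has a strategy forcing, against every Painter, a red `P_k` or a blue `P_n`
within at most `t` rounds. -/
noncomputable def onlineRamseyPath (k n : ℕ) : ℕ :=
  sInf {t : ℕ | ∃ B : BuilderStrat, BuilderOK emptyCol B ∧
    ∀ P : PainterStrat, ∃ s ≤ t, Ends k n (play emptyCol B P s)}

/-- Painter plays legally in the game `RR_H(P_k, ⬝)`: he never colours an edge red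
if that would create a red path on `k` vertices. -/
def PainterOK (k : ℕ) (P : PainterStrat) : Prop :=
  ∀ (C : Coloring) (e : Sym2 ℕ),
    ¬HasPath C true k → HasPath (Function.update C e (some true)) true k →
      P C e = false

/-- The colour `c` is an allowed answer of Painter on the edge `e` in position `C`
of the game `RR(P_k, ⬝)`. -/
def Allowed (k : ℕ) (C : Coloring) (e : Sym2 ℕ) (c : Bool) : Prop :=
  c = true → ¬HasPath C true k → ¬HasPath (Function.update C e (some true)) true k

/-- One round in the variant where Builder may reselect an already coloured edge,
in which case it keeps its colour. -/
def stepR (C : Coloring) (e : Sym2 ℕ) (c : Bool) : Coloring :=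
  if C e = none then Function.update C e (some c) else C

/-- The position after `t` rounds, in the variant where a reselected edge keeps
its colour (and the round still counts). -/
def playR (C0 : Coloring) (B : BuilderStrat) (P : PainterStrat) : ℕ → Coloring
  | 0 => C0
  | t + 1 =>
    stepR (playR C0 B P t) (B (playR C0 B P t))
      (P (playR C0 B P t) (B (playR C0 B P t)))

/-- Builder plays legally in the reselection variant: he selects non-loop edges. -/
def BuilderOKR (C0 : Coloring) (B : BuilderStrat) : Prop :=
  ∀ (P : PainterStrat) (t : ℕ), ¬(B (playR C0 B P t)).IsDiag

/-- Consecutive members of `l` are joined by blue edges. -/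
def BlueChain (C : Coloring) (l : List ℕ) : Prop :=
  l.Chain' fun a b => C s(a, b) = some false

/-- Consecutive members of `l` are joined by red edges. -/
def RedChain (C : Coloring) (l : List ℕ) : Prop :=
  l.Chain' fun a b => C s(a, b) = some true

/-- `l` is the vertex sequence of a blue path (on at least one vertex) in `C`. -/
def IsBluePath (C : Coloring) (l : List ℕ) : Prop :=
  l ≠ [] ∧ l.Nodup ∧ BlueChain C l

/-- `l` is the vertex sequence of a red path (on at least one vertex) in `C`. -/
def IsRedPath (C : Coloring) (l : List ℕ) : Prop :=
  l ≠ [] ∧ l.Nodup ∧ RedChain C l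

/-- `x` is an end of the path with vertex sequence `l`. -/
def IsEnd (x : ℕ) (l : List ℕ) : Prop :=
  l.head? = some x ∨ l.getLast? = some x

/-- `e` joins two consecutive vertices of `l`, i.e. `e` is an edge of the path `l`. -/
def IsPathEdge (l : List ℕ) (e : Sym2 ℕ) : Prop :=
  ∃ (i : ℕ) (h : i + 1 < l.length),
    e = s(l.get ⟨i, Nat.lt_of_succ_lt h⟩, l.get ⟨i + 1, h⟩)

/-- The paths of the family `G` are pairwise vertex-disjoint. -/
def DisjFam {s : ℕ} (G : Fin s → List ℕ) : Prop :=
  ∀ i j, i ≠ j → ∀ x, x ∈ G i → x ∉ G j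

/-- `C` contains `T` pairwise vertex-disjoint blue paths of length 2
(i.e. on 3 vertices each). -/
def HasDisjointBluePaths3 (C : Coloring) (T : ℕ) : Prop :=
  ∃ G : Fin T → List ℕ,
    (∀ i, (G i).length = 3 ∧ IsBluePath C (G i)) ∧ DisjFam G

/-- `(G, u)` witnesses that `C` contains an essential `(s,d,m)`-graph:
`G` lists the `s` pairwise disjoint nonempty essential blue paths,
`u` lists the vertices of the essential red path, `u i` being an end of `G i`,
and the blue paths have `m` vertices in total. -/
def IsEssWitness (C : Coloring) (s d m : ℕ)
    (G : Fin s → List ℕ) (u : Fin d → ℕ) : Prop :=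
  (∀ i, IsBluePath C (G i)) ∧ DisjFam G ∧
  Function.Injective u ∧
  (∀ i j : Fin d, (j : ℕ) = (i : ℕ) + 1 → C s(u i, u j) = some true) ∧
  (∀ (i : Fin d) (h : (i : ℕ) < s), IsEnd (u i) (G ⟨i, h⟩)) ∧
  (∑ i, (G i).length) = m

/-- `C` contains an essential `(s,d,m)`-graph. -/
def IsEssGraph (C : Coloring) (s d m : ℕ) : Prop :=
  d ≤ s ∧ ∃ (G : Fin s → List ℕ) (u : Fin d → ℕ), IsEssWitness C s d m G u

/-- `C` contains an `(s,d,m)`-fence: a red picket `R` on `d` vertices whose last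
vertex is the first vertex of the blue picket `G 0`, further pairwise disjoint
nonempty blue pickets `G 1, …`, the blue pickets having `m` vertices in total. -/
def IsFence (C : Coloring) (s d m : ℕ) : Prop :=
  ∃ (hs : 0 < s) (R : List ℕ) (G : Fin s → List ℕ),
    R.length = d ∧ IsRedPath C R ∧
    (∀ i, IsBluePath C (G i)) ∧ DisjFam G ∧
    R.getLast? = (G ⟨0, hs⟩).head? ∧
    (∀ x ∈ R.dropLast, ∀ i, x ∉ G i) ∧
    (∑ i, (G i).length) = m

/-- There is a red path of length `len` (i.e. on `len + 1` vertices) with end `x`. -/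
def RedTailAt (C : Coloring) (x : ℕ) (len : ℕ) : Prop :=
  ∃ l : List ℕ, l.length = len + 1 ∧ l.head? = some x ∧ IsRedPath C l

/-- `l` is a blue `(1,1)`-path: a blue path such that each of its two ends is an
end of a red path of length 1. -/
def IsBlue11Path (C : Coloring) (l : List ℕ) : Prop :=
  IsBluePath C l ∧
  (∀ x, l.head? = some x → RedTailAt C x 1) ∧
  (∀ x, l.getLast? = some x → RedTailAt C x 1)

/-- `l = [u_1, …, u_k, u_{k+1}]` is an extended `(2,0)`-path: `k ≥ 2`, the edge
`u_k u_{k+1}` is red and `u_1 … u_k` is a blue `(2,0)`-path with `2`-end `u_k`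
(its blue end is `u_1`, its transition vertex `u_k`, its red end `u_{k+1}`). -/
def IsExtPath (C : Coloring) (l : List ℕ) : Prop :=
  3 ≤ l.length ∧ l.Nodup ∧ BlueChain C l.dropLast ∧
  ∀ a b, l.dropLast.getLast? = some a → l.getLast? = some b →
    C s(a, b) = some true ∧ RedTailAt C a 2

/-- The vertices `x 0, …, x 4` form a limb in `C`: blue edges `x0x1`, `x2x3`,
`x1x4` and a red edge `x1x2` (paper notation: blue `x1x2, x3x4, x2x5`, red `x2x3`). -/
def IsLimb (C : Coloring) (x : Fin 5 → ℕ) : Prop :=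
  Function.Injective x ∧
  C s(x 0, x 1) = some false ∧ C s(x 2, x 3) = some false ∧
  C s(x 1, x 4) = some false ∧ C s(x 1, x 2) = some true

/-- The four edges of the limb on `x 0, …, x 4`. -/
def limbEdgeSet (x : Fin 5 → ℕ) : Set (Sym2 ℕ) :=
  {s(x 0, x 1), s(x 2, x 3), s(x 1, x 4), s(x 1, x 2)}

/-- The limb on `x 0, …, x 4` is a component of `C`: every edge of `C` meeting
a limb vertex is an edge of the limb. -/
def LimbComponent (C : Coloring) (x : Fin 5 → ℕ) : Prop :=
  ∀ e, C e ≠ none → (∃ v ∈ e, v ∈ Set.range x) → e ∈ limbEdgeSet x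

/-- The red edges of `C` with at least one end in `S`. -/
def RedAt (C : Coloring) (S : Set ℕ) : Set (Sym2 ℕ) :=
  {e | C e = some true ∧ ∃ v ∈ e, v ∈ S}

/-- The blue edges of `C` with at least one end in `S`. -/
def BlueAt (C : Coloring) (S : Set ℕ) : Set (Sym2 ℕ) :=
  {e | C e = some false ∧ ∃ v ∈ e, v ∈ S}

def redEdges (C : Coloring) : Set (Sym2 ℕ) := {e | C e = some true}

def blueEdges (C : Coloring) : Set (Sym2 ℕ) := {e | C e = some false}

def allEdges (C : Coloring) : Set (Sym2 ℕ) := {e | C e ≠ none}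

/-- The vertices of the coloured graph `C` (ends of coloured edges). -/
def supp (C : Coloring) : Set ℕ := {v | ∃ e, C e ≠ none ∧ v ∈ e}

/-- `a` and `b` are adjacent in `C`. -/
def Adj (C : Coloring) (a b : ℕ) : Prop := a ≠ b ∧ C s(a, b) ≠ none

/-- `G_0 ∪ Red_H(G_0)` is a component of the coloured graph: every blue edge
meeting the blue path `l` is an edge of `l`, and the other end `y` of any red
edge leaving `l` meets only red edges coming back to `l`. -/
def G0Component (C : Coloring) (l : List ℕ) : Prop :=
  (∀ e, C e = some false → (∃ v ∈ e, v ∈ l) → IsPathEdge l e) ∧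
  (∀ x ∈ l, ∀ y : ℕ, C s(x, y) = some true → y ∉ l →
    ∀ e, C e ≠ none → y ∈ e → C e = some true ∧ ∃ v ∈ e, v ∈ l)

/-- The underlying list of an optional path (`∅` has no vertices). -/
def listOf (o : Option (List ℕ)) : List ℕ := o.getD []

/-- The vertex set of an optional limb. -/
def limbVertsOf : Option (Fin 5 → ℕ) → Set ℕ
  | none => ∅
  | some x => Set.range x

/-- The data of the four (possibly empty) essential subgraphs `(G_0, G_1, G_2, L)`
of a good graph: `G0` is a blue path, `G1` a blue `(1,1)`-path, `G2` an extended
`(2,0)`-path (each given by its vertex sequence), and `L` a limb. -/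
structure GoodData where
  G0 : Option (List ℕ)
  G1 : Option (List ℕ)
  G2 : Option (List ℕ)
  L : Option (Fin 5 → ℕ)

def GoodData.vG0 (D : GoodData) : ℕ := (listOf D.G0).length
def GoodData.vG1 (D : GoodData) : ℕ := (listOf D.G1).length
def GoodData.vG2 (D : GoodData) : ℕ := (listOf D.G2).length
def GoodData.vL (D : GoodData) : ℕ := match D.L with | none => 0 | some _ => 5

/-- The number of essential vertices. -/
def GoodData.ess (D : GoodData) : ℕ := D.vG0 + D.vG1 + D.vG2 + D.vL

/-- The set of essential vertices. -/
def GoodData.verts (D : GoodData) : Set ℕ :=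
  {v | v ∈ listOf D.G0} ∪ {v | v ∈ listOf D.G1} ∪ {v | v ∈ listOf D.G2} ∪
    limbVertsOf D.L

/-- The essential subgraphs are pairwise vertex-disjoint. -/
def GoodData.PartsDisjoint (D : GoodData) : Prop :=
  (∀ x ∈ listOf D.G0, x ∉ listOf D.G1) ∧
  (∀ x ∈ listOf D.G0, x ∉ listOf D.G2) ∧
  (∀ x ∈ listOf D.G0, x ∉ limbVertsOf D.L) ∧
  (∀ x ∈ listOf D.G1, x ∉ listOf D.G2) ∧
  (∀ x ∈ listOf D.G1, x ∉ limbVertsOf D.L) ∧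
  (∀ x ∈ listOf D.G2, x ∉ limbVertsOf D.L)

/-- At least three of the four essential subgraphs are empty. -/
def GoodData.Simple (D : GoodData) : Prop :=
  (D.G0 = none ∧ D.G1 = none ∧ D.G2 = none) ∨
  (D.G0 = none ∧ D.G1 = none ∧ D.L = none) ∨
  (D.G0 = none ∧ D.G2 = none ∧ D.L = none) ∨
  (D.G1 = none ∧ D.G2 = none ∧ D.L = none)

/-- `C` is a good graph with essential subgraphs `D = (G_0, G_1, G_2, L)`:
conditions (A)–(F) of the paper, where `⌈2x/5⌉ = (2x+4)/5` in `ℕ`. -/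
def IsGood (C : Coloring) (D : GoodData) : Prop :=
  -- `C` is a (finite) coloured graph
  (allEdges C).Finite ∧
  (∀ e, C e ≠ none → ¬e.IsDiag) ∧
  -- the essential subgraphs are pairwise vertex-disjoint
  D.PartsDisjoint ∧
  -- (A): `L = ∅` or `L` is a limb and a component of `C`
  (∀ x, D.L = some x → IsLimb C x ∧ LimbComponent C x) ∧
  -- (B): `G0 = ∅` or `G0` is a blue path, `G0 ∪ Red_H(G0)` is a component,
  -- and `|Red_H(G0)| ≤ ⌈2 v(G0)/5⌉ - 1`
  (∀ l, D.G0 = some l → IsBluePath C l ∧ G0Component C l ∧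
    (RedAt C {v | v ∈ l}).ncard + 1 ≤ (2 * l.length + 4) / 5) ∧
  -- (C): `G2 = ∅` or `G2` is an extended (2,0)-path on ≥ 3 vertices
  (∀ l, D.G2 = some l → IsExtPath C l) ∧
  -- (C): `G1 = ∅` or `G1` is a blue (1,1)-path whose 1-ends are not adjacent
  -- to the blue end, the red end or the transition vertex of `G2`
  (∀ l, D.G1 = some l → IsBlue11Path C l ∧
    ∀ l2, D.G2 = some l2 → ∀ a, IsEnd a l → ∀ b : ℕ,
      (l2.head? = some b ∨ l2.getLast? = some b ∨ l2.dropLast.getLast? = some b) →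
      ¬Adj C a b) ∧
  -- (C): `Blue_H(G1 ∪ G2) \ E(G1 ∪ G2) = ∅`
  (∀ e, C e = some false → (∃ v ∈ e, v ∈ listOf D.G1 ∨ v ∈ listOf D.G2) →
    IsPathEdge (listOf D.G1) e ∨ IsPathEdge (listOf D.G2) e) ∧
  -- (C): `|Red_H(G1 ∪ G2)| ≤ ⌈2 v(G1 ∪ G2)/5⌉`
  (RedAt C {v | v ∈ listOf D.G1 ∨ v ∈ listOf D.G2}).ncard ≤
    (2 * (D.vG1 + D.vG2) + 4) / 5 ∧
  -- (D), (E): every edge of `C` has an end among the essential vertices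
  (∀ e, C e ≠ none → ∃ v ∈ e, v ∈ D.verts) ∧
  -- (F)
  (5 ∣ D.vG0 ∨ 5 ∣ D.vG1 + D.vG2)

/-- `C` is a very good graph with essential subgraphs `D`: condition (G). -/
def IsVeryGood (C : Coloring) (D : GoodData) : Prop :=
  IsGood C D ∧ 5 ∣ D.vG0 ∧ 5 ∣ D.vG1 + D.vG2

open Classical in
/-- Delete from `C` the vertices of `S` together with all incident edges. -/
noncomputable def deleteVerts (C : Coloring) (S : Set ℕ) : Coloring :=
  fun e => if ∃ v ∈ e, v ∈ S then none else C e

/-- The union of two (edge-disjoint) coloured graphs. -/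
def unionCol (C C' : Coloring) : Coloring :=
  fun e => match C e with
    | some c => some c
    | none => C' e

end OSR

namespace OSR

lemma update_eq_some_of_eq_some {F : Coloring} {e e' : Sym2 ℕ} {a c : Bool} (he : F e = none)
    (h : F e' = some a) : Function.update F e (some c) e' = some a := by
  rw [Function.update_of_ne, h]
  rintro rfl
  simp [he] at h

lemma IsBluePath.update {F : Coloring} {e : Sym2 ℕ} {l : List ℕ} (hl : IsBluePath F l)
    (he : F e = none) (c : Bool) : IsBluePath (Function.update F e (some c)) l :=
  ⟨hl.1, hl.2.1, List.IsChain.imp (fun _ _ h => update_eq_some_of_eq_some he h) hl.2.2⟩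

lemma IsBluePath.reverse {C : Coloring} {l : List ℕ} (hl : IsBluePath C l) :
    IsBluePath C l.reverse := by
  refine ⟨by simpa using hl.1, by simpa using hl.2.1, ?_⟩
  refine List.isChain_reverse.2 (List.IsChain.imp (fun a b h => ?_) hl.2.2)
  rwa [Sym2.eq_swap]

lemma IsEnd.mem {x : ℕ} {l : List ℕ} (h : IsEnd x l) : x ∈ l :=
  h.elim List.mem_of_head? List.mem_of_getLast?

lemma IsBluePath.exists_perm_head {C : Coloring} {l : List ℕ} {x : ℕ} (hl : IsBluePath C l)
    (hx : IsEnd x l) : ∃ l', l'.Perm l ∧ IsBluePath C l' ∧ l'.head? = some x := by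
  rcases hx with hx | hx
  · exact ⟨l, .refl l, hl, hx⟩
  · exact ⟨l.reverse, l.reverse_perm, hl.reverse, by simpa using hx⟩

/-- Two disjoint blue paths joined by a blue edge between their ends form a blue path. -/
lemma IsBluePath.exists_perm_append {C : Coloring} {l₁ l₂ : List ℕ} {x y : ℕ}
    (h₁ : IsBluePath C l₁) (h₂ : IsBluePath C l₂) (hdisj : l₁.Disjoint l₂)
    (hx : IsEnd x l₁) (hy : IsEnd y l₂) (hxy : C s(x, y) = some false) :
    ∃ l, l.Perm (l₁ ++ l₂) ∧ IsBluePath C l := by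
  obtain ⟨k₁, p₁, b₁, e₁⟩ := h₁.exists_perm_head hx
  obtain ⟨k₂, p₂, b₂, e₂⟩ := h₂.exists_perm_head hy
  have hp : (k₁.reverse ++ k₂).Perm (l₁ ++ l₂) := (k₁.reverse_perm.trans p₁).append p₂
  refine ⟨_, hp, by simp [b₁.1], hp.nodup_iff.2 (h₁.2.1.append h₂.2.1 hdisj), ?_⟩
  refine List.isChain_append.2 ⟨b₁.reverse.2.2, b₂.2.2, ?_⟩
  simpa [e₁, e₂] using hxy

/-- The family `G` with its `q`-th member replaced by `L` and its `p`-th member deleted. -/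
def mergeFam {n : ℕ} (G : Fin (n + 1) → List ℕ) (p q : Fin (n + 1)) (L : List ℕ) :
    Fin n → List ℕ :=
  fun i => Function.update G q L (p.succAbove i)

lemma DisjFam.mergeFam {n : ℕ} {G : Fin (n + 1) → List ℕ} (hG : DisjFam G)
    {p q : Fin (n + 1)} {L : List ℕ} (hL : L.Perm (G q ++ G p)) :
    DisjFam (mergeFam G p q L) := by
  intro i j hij x hi hj
  have hne : p.succAbove i ≠ p.succAbove j := fun h => hij (Fin.succAbove_right_injective h)
  have hpi := p.succAbove_ne i
  have hpj := p.succAbove_ne j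
  simp only [OSR.mergeFam, Function.update_apply] at hi hj
  split_ifs at hi hj with h₁ h₂ h₂
  · exact hne (h₁.trans h₂.symm)
  · rcases List.mem_append.1 (hL.mem_iff.1 hi) with h | h
    · exact hG _ _ h₂ x hj h
    · exact hG _ _ hpj x hj h
  · rcases List.mem_append.1 (hL.mem_iff.1 hj) with h | h
    · exact hG _ _ h₁ x hi h
    · exact hG _ _ hpi x hi h
  · exact hG _ _ hne x hi hj

lemma sum_length_mergeFam {n : ℕ} {G : Fin (n + 1) → List ℕ} {p q : Fin (n + 1)} (hpq : q ≠ p)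
    {L : List ℕ} (hL : L.Perm (G q ++ G p)) :
    ∑ i, (mergeFam G p q L i).length = ∑ i, (G i).length := by
  obtain ⟨r, rfl⟩ := Fin.exists_succAbove_eq hpq
  rw [Fin.sum_univ_succAbove _ p, ← Finset.add_sum_erase _ _ (Finset.mem_univ r),
    ← Finset.add_sum_erase Finset.univ (fun i => (G (p.succAbove i)).length) (Finset.mem_univ r)]
  have hr : (mergeFam G p (p.succAbove r) L r).length
      = (G (p.succAbove r)).length + (G p).length := by
    simp [mergeFam, hL.length_eq]
  have hrest : ∑ i ∈ Finset.univ.erase r, (mergeFam G p (p.succAbove r) L i).length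
      = ∑ i ∈ Finset.univ.erase r, (G (p.succAbove i)).length := by
    refine Finset.sum_congr rfl fun i hi => ?_
    rw [mergeFam, Function.update_of_ne]
    exact fun h => Finset.ne_of_mem_erase hi (Fin.succAbove_right_injective h)
  rw [hr, hrest]
  omega

/-- Adding the red edge from the last red vertex to `w` extends the essential red path. -/
lemma IsEssWitness.snoc_red {F : Coloring} {s k m : ℕ} {G : Fin s → List ℕ}
    {u : Fin (k + 1) → ℕ} (hwit : IsEssWitness F s (k + 1) m G u) (hds : k + 1 < s) {w : ℕ}
    (hw : IsEnd w (G ⟨k + 1, hds⟩)) (hnew : F s(u (Fin.last k), w) = none) :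
    IsEssWitness (Function.update F s(u (Fin.last k), w) (some true)) s (k + 2) m G
      (Fin.snoc u w : Fin (k + 2) → ℕ) := by
  obtain ⟨hb, hdis, hinj, hred, hend, hsum⟩ := hwit
  refine ⟨fun i => (hb i).update hnew true, hdis, ?_, ?_, ?_, hsum⟩
  · refine Fin.snoc_injective_iff.2 ⟨hinj, ?_⟩
    rintro ⟨i, rfl⟩
    refine hdis ⟨i, by omega⟩ ⟨k + 1, hds⟩ ?_ _ (hend i (by omega)).mem hw.mem
    simp only [ne_eq, Fin.mk.injEq]
    omega
  · intro i j hij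
    induction i using Fin.lastCases with
    | last => simp at hij; omega
    | cast i =>
      induction j using Fin.lastCases with
      | last =>
        obtain rfl : i = Fin.last k := by ext; simp at hij ⊢; omega
        simp
      | cast j =>
        simp only [Fin.snoc_castSucc]
        exact update_eq_some_of_eq_some hnew (hred i j (by simpa using hij))
  · intro i h
    induction i using Fin.lastCases with
    | last => simpa using hw
    | cast i => simpa using hend i (by simpa using h)

/-- Adding a blue edge from the last red vertex to `w` merges two essential blue paths. -/
lemma IsEssWitness.merge_blue {F : Coloring} {n k m : ℕ} {G : Fin (n + 1) → List ℕ}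
    {u : Fin (k + 1) → ℕ} (hwit : IsEssWitness F (n + 1) (k + 1) m G u) (hds : k + 1 < n + 1)
    {w : ℕ} (hw : IsEnd w (G ⟨k + 1, hds⟩)) (hnew : F s(u (Fin.last k), w) = none) :
    ∃ d', 1 ≤ d' ∧ (d' = k ∨ d' = k + 1) ∧
      IsEssGraph (Function.update F s(u (Fin.last k), w) (some false)) n d' m := by
  obtain ⟨hb, hdis, hinj, hred, hend, hsum⟩ := hwit
  set C := Function.update F s(u (Fin.last k), w) (some false) with hC
  have hbC : ∀ i, IsBluePath C (G i) := fun i => (hb i).update hnew false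
  set p : Fin (n + 1) := ⟨k + 1, hds⟩ with hp
  set q : Fin (n + 1) := ⟨k, by omega⟩ with hq
  have hqp : q ≠ p := by simp [hp, hq]
  obtain ⟨L, hL, hLb⟩ := (hbC q).exists_perm_append (hbC p) (fun x h₁ h₂ => hdis q p hqp x h₁ h₂)
    (hend (Fin.last k) (by simp; omega)) hw (by simp [hC])
  have hMb : ∀ i, IsBluePath C (mergeFam G p q L i) := fun i => by
    unfold mergeFam
    rw [Function.update_apply]
    split_ifs
    exacts [hLb, hbC _]
  have hMs := (sum_length_mergeFam hqp hL).trans hsum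
  rcases Nat.eq_zero_or_pos k with rfl | hk
  · refine ⟨1, le_rfl, .inr rfl, by omega, mergeFam G p q L,
      fun _ => (mergeFam G p q L ⟨0, by omega⟩).head (hMb _).1, hMb, hdis.mergeFam hL,
      Function.injective_of_subsingleton _, fun i j h => by omega, fun i h => .inl ?_, hMs⟩
    obtain rfl : i = 0 := Subsingleton.elim _ _
    exact List.head?_eq_some_head _
  · refine ⟨k, hk, .inl rfl, by omega, mergeFam G p q L, fun i => u i.castSucc, hMb,
      hdis.mergeFam hL, hinj.comp (Fin.castSucc_injective k),
      fun i j h => update_eq_some_of_eq_some hnew (hred _ _ (by simpa using h)),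
      fun i h => ?_, hMs⟩
    have hs : p.succAbove ⟨i, h⟩ = ⟨i, by omega⟩ :=
      Fin.succAbove_of_castSucc_lt _ _ (by simp [hp, Fin.lt_def])
    rw [mergeFam, hs, Function.update_of_ne (by simp [hq]; omega)]
    exact hend i.castSucc (by simp; omega)

end OSR

/-- **Lemma 2.** If `1 ≤ d < s ≤ m`, the coloured graph `F` contains an essential
`(s,d,m)`-graph with blue paths `G` and red path `u`, `w` is an end of `G_{d+1}`,
and the edge `u_d w` is added to `F` in either colour, then the resulting graph
contains an essential `(s',d',m)`-graph with either `d' = d + 1` and `s' = s`, or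
`s' = s − 1` and `d' ∈ {d−1, d}`, `d' ≥ 1`. -/
theorem OSR.gluepk1 (F : OSR.Coloring) (s d m : ℕ)
    (hd : 1 ≤ d) (hds : d < s) (hsm : s ≤ m)
    (G : Fin s → List ℕ) (u : Fin d → ℕ)
    (hwit : OSR.IsEssWitness F s d m G u)
    (w : ℕ) (hw : OSR.IsEnd w (G ⟨d, hds⟩))
    (hnew : F s(u ⟨d - 1, by omega⟩, w) = none) (c : Bool) :
    ∃ s' d' : ℕ,
      OSR.IsEssGraph
        (Function.update F s(u ⟨d - 1, by omega⟩, w) (some c)) s' d' m ∧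
      ((d' = d + 1 ∧ s' = s) ∨
        (s' = s - 1 ∧ 1 ≤ d' ∧ (d' = d - 1 ∨ d' = d))) := by
  obtain ⟨k, rfl⟩ : ∃ k, d = k + 1 := ⟨d - 1, by omega⟩
  obtain ⟨n, rfl⟩ : ∃ n, s = n + 1 := ⟨s - 1, by omega⟩
  cases c with
  | true =>
    exact ⟨n + 1, k + 2, ⟨hds, G, _, hwit.snoc_red hds hw hnew⟩, .inl ⟨rfl, rfl⟩⟩
  | false =>
    obtain ⟨d', h₁, hd', hG⟩ := hwit.merge_blue hds hw hnew
    exact ⟨n, d', hG, .inr ⟨rfl, h₁, hd'⟩⟩
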